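/- Measuring action of a cleft extension: Let k be a field, B a Hopf algebra over k, and (E,ρ) a right B-comodule algebra with coinvariants X = E^{coB}. Let γ : B → E be a k-linear right B-comodule map (ρ ∘ γ = (γ ⊗ id_B) ∘ Δ) which is convolution invertible, i.e. there is a k-linear γ⁻¹ : B → E with Σ γ(b₍₁₎)γ⁻¹(b₍₂₎) = ε(b)1_E = Σ γ⁻¹(b₍₁₎)γ(b₍₂₎) for all b ∈ B. Then for every b ∈ B and u ∈ X the element b ▷ u := Σ γ(b₍₁₎)·u·γ⁻¹(b₍₂₎) again lies in X, and the resulting map ▷ : B ⊗ X → X measures X: b ▷ 1 = ε(b)1 and b ▷ (uv) = Σ (b₍₁₎ ▷ u)(b₍₂₎ ▷ v) for all u, v ∈ X. -/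

import Mathlib

open scoped TensorProduct

/-- `(E, ρ)` is a right `B`-comodule algebra. -/
structure IsComoduleAlgebra (k : Type*) [CommRing k]
    (B : Type*) [Ring B] [Bialgebra k B]
    {E : Type*} [Ring E] [Algebra k E]
    (ρ : E →ₐ[k] E ⊗[k] B) : Prop where
  coassoc : ∀ e : E,
      TensorProduct.assoc k E B B (TensorProduct.map ρ.toLinearMap LinearMap.id (ρ e))
        = TensorProduct.map LinearMap.id (Coalgebra.comul (R := k) (A := B)) (ρ e)
  counit : ∀ e : E,
      TensorProduct.rid k E
        (TensorProduct.map LinearMap.id (Coalgebra.counit (R := k) (A := B)) (ρ e)) = e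

/-- The coinvariants `E^{co B} = {e | ρ e = e ⊗ 1}` of a right `B`-comodule algebra. -/
def coinvariants (k : Type*) [CommRing k] {B : Type*} [Ring B] [Bialgebra k B]
    {E : Type*} [Ring E] [Algebra k E] (ρ : E →ₐ[k] E ⊗[k] B) : Set E :=
  {e | ρ e = e ⊗ₜ[k] (1 : B)}

/-- The map `b ▷ u = Σ γ(b₍₁₎)·u·γ⁻¹(b₍₂₎)` built from a `k`-linear map `γ : B → E` and a
candidate convolution inverse `γinv`, as a `k`-linear map in `b` for each fixed `u`. -/
noncomputable def cleftAction {k : Type*} [CommRing k]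
    {B : Type*} [Ring B] [Bialgebra k B]
    {E : Type*} [Ring E] [Algebra k E]
    (γ γinv : B →ₗ[k] E) (u : E) : B →ₗ[k] E :=
  (LinearMap.mul' k E) ∘ₗ
    (TensorProduct.map ((LinearMap.mulRight k u) ∘ₗ γ) γinv) ∘ₗ
    (Coalgebra.comul (R := k) (A := B))

open WithConv in
/-- Constant convolution element. -/
noncomputable def cConst (k : Type*) [CommRing k] (B : Type*) [Ring B] [Bialgebra k B]
    {A : Type*} [Ring A] [Algebra k A] (u : A) : WithConv (B →ₗ[k] A) :=
  toConv ((LinearMap.toSpanSingleton k A u) ∘ₗ Coalgebra.counit)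

open WithConv in
theorem conv_mul_cConst {k : Type*} [CommRing k] {B : Type*} [Ring B] [Bialgebra k B]
    {A : Type*} [Ring A] [Algebra k A] (f : B →ₗ[k] A) (u : A) :
    toConv f * cConst k B u = toConv ((LinearMap.mulRight k u) ∘ₗ f) := by
  ext b
  obtain r := Coalgebra.Repr.arbitrary k b
  rw [r.convMul_apply]
  have h2 : ∑ i ∈ r.index, Coalgebra.counit (R := k) (r.right i) • r.left i = b := by
    have := Coalgebra.sum_tmul_counit_eq (R := k) r
    have := congrArg (TensorProduct.rid k B) this
    simpa only [map_sum, TensorProduct.rid_tmul, one_smul] using this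
  conv_rhs => rw [← h2]
  simp [cConst, Finset.sum_mul]

open WithConv in
theorem cConst_mul_conv {k : Type*} [CommRing k] {B : Type*} [Ring B] [Bialgebra k B]
    {A : Type*} [Ring A] [Algebra k A] (f : B →ₗ[k] A) (u : A) :
    cConst k B u * toConv f = toConv ((LinearMap.mulLeft k u) ∘ₗ f) := by
  ext b
  obtain r := Coalgebra.Repr.arbitrary k b
  rw [r.convMul_apply]
  have h2 : ∑ i ∈ r.index, Coalgebra.counit (R := k) (r.left i) • r.right i = b := by
    have := Coalgebra.sum_counit_tmul_eq (R := k) r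
    have := congrArg (TensorProduct.lid k B) this
    simpa only [map_sum, TensorProduct.lid_tmul, one_smul] using this
  conv_rhs => rw [← h2]
  simp [cConst, Finset.mul_sum]

open WithConv in
theorem conv_push {k : Type*} [CommRing k] {B : Type*} [Ring B] [Bialgebra k B]
    {A C : Type*} [Ring A] [Algebra k A] [Ring C] [Algebra k C] (h : A →ₐ[k] C)
    (f g : WithConv (B →ₗ[k] A)) :
    toConv (h.toLinearMap ∘ₗ (f * g).ofConv) =
      toConv (h.toLinearMap ∘ₗ f.ofConv) * toConv (h.toLinearMap ∘ₗ g.ofConv) := by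
  ext b
  obtain r := Coalgebra.Repr.arbitrary k b
  rw [r.convMul_apply]
  have := r.convMul_apply f g
  change h ((f * g) b) = _
  rw [this]
  simp

open WithConv in
theorem cleft_eq {k : Type*} [CommRing k] {B : Type*} [Ring B] [Bialgebra k B]
    {E : Type*} [Ring E] [Algebra k E] (γ γinv : B →ₗ[k] E) (u : E) :
    toConv (cleftAction γ γinv u) = toConv γ * cConst k B u * toConv γinv := by
  rw [conv_mul_cConst]
  rfl

/-- **Measuring action of a cleft extension.** Let `B` be a Hopf algebra over a field
`k`, `(E, ρ)` a right `B`-comodule algebra with coinvariants `X = E^{co B}`, and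
`γ : B → E` a convolution-invertible `k`-linear right `B`-comodule map with convolution
inverse `γ⁻¹`.  Then for all `b ∈ B` and `u ∈ X` the element
`b ▷ u = Σ γ(b₍₁₎)·u·γ⁻¹(b₍₂₎)` lies in `X`, and `▷` measures `X`:
`b ▷ 1 = ε(b)·1` and `b ▷ (u·v) = Σ (b₍₁₎ ▷ u)·(b₍₂₎ ▷ v)`. -/
theorem cleft_extension_measures_coinvariants
    {k : Type*} [Field k] {B : Type*} [Ring B] [HopfAlgebra k B]
    {E : Type*} [Ring E] [Algebra k E]
    (ρ : E →ₐ[k] E ⊗[k] B) (hρ : IsComoduleAlgebra k B ρ)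
    (γ γinv : B →ₗ[k] E)
    (hγ : ∀ b : B, ρ (γ b) =
      TensorProduct.map γ LinearMap.id (Coalgebra.comul (R := k) (A := B) b))
    (hconv₁ : ∀ b : B,
      LinearMap.mul' k E
        (TensorProduct.map γ γinv (Coalgebra.comul (R := k) (A := B) b))
        = (Coalgebra.counit (R := k) (A := B) b) • (1 : E))
    (hconv₂ : ∀ b : B,
      LinearMap.mul' k E
        (TensorProduct.map γinv γ (Coalgebra.comul (R := k) (A := B) b))
        = (Coalgebra.counit (R := k) (A := B) b) • (1 : E)) :
    (∀ (b : B), ∀ u ∈ coinvariants k ρ, cleftAction γ γinv u b ∈ coinvariants k ρ) ∧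
    (∀ b : B, cleftAction γ γinv (1 : E) b = (Coalgebra.counit (R := k) (A := B) b) • (1 : E)) ∧
    (∀ (b : B), ∀ u ∈ coinvariants k ρ, ∀ v ∈ coinvariants k ρ,
      cleftAction γ γinv (u * v) b =
        LinearMap.mul' k E
          (TensorProduct.map (cleftAction γ γinv u) (cleftAction γ γinv v)
            (Coalgebra.comul (R := k) (A := B) b))) := by
  have e1 : WithConv.toConv γ * WithConv.toConv γinv = 1 := by
    ext b
    refine (hconv₁ b).trans ?_
    simp [Algebra.algebraMap_eq_smul_one]
  have e2 : WithConv.toConv γinv * WithConv.toConv γ = 1 := by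
    ext b
    refine (hconv₂ b).trans ?_
    simp [Algebra.algebraMap_eq_smul_one]
  refine ⟨?_, ?_, ?_⟩
  · intro b u hu
    have hu' : ρ u = u ⊗ₜ[k] (1 : B) := hu
    let ι : E →ₐ[k] E ⊗[k] B := Algebra.TensorProduct.includeLeft
    let j : WithConv (B →ₗ[k] E ⊗[k] B) := WithConv.toConv
      (Algebra.TensorProduct.includeRight : B →ₐ[k] E ⊗[k] B).toLinearMap
    let P : ∀ {h : E →ₐ[k] E ⊗[k] B} (f : WithConv (B →ₗ[k] E)), WithConv (B →ₗ[k] E ⊗[k] B) :=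
      fun {h} f => WithConv.toConv (h.toLinearMap ∘ₗ f.ofConv)
    have hmul : ∀ (h : E →ₐ[k] E ⊗[k] B) f g, P (h := h) (f * g) = P (h := h) f * P (h := h) g :=
      fun h f g => conv_push h f g
    have hone : ∀ (h : E →ₐ[k] E ⊗[k] B), P (h := h) 1 = 1 := by
      intro h
      ext b
      change h ((1 : WithConv (B →ₗ[k] E)) b) = _
      simp
    have hconst : ∀ (h : E →ₐ[k] E ⊗[k] B), P (h := h) (cConst k B u) = cConst k B (h u) := by
      intro h
      ext b
      simp [P, cConst]
    have hρι : ρ u = ι u := hu'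
    have hργ : P (h := ρ) (WithConv.toConv γ) = P (h := ι) (WithConv.toConv γ) * j := by
      ext b
      obtain r := Coalgebra.Repr.arbitrary k b
      rw [r.convMul_apply]
      refine (hγ b).trans ?_
      rw [← r.eq]
      simp [P, ι, j]
    have hcomm : j * cConst k B (ι u) = cConst k B (ι u) * j := by
      rw [conv_mul_cConst, cConst_mul_conv]
      ext b
      simp [ι]
    have hj : j * P (h := ρ) (WithConv.toConv γinv) = P (h := ι) (WithConv.toConv γinv) := by
      have a : P (h := ι) (WithConv.toConv γ) * (j * P (h := ρ) (WithConv.toConv γinv)) = 1 := by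
        rw [← mul_assoc, ← hργ, ← hmul, e1, hone]
      have c : P (h := ι) (WithConv.toConv γinv) * P (h := ι) (WithConv.toConv γ) = 1 := by
        rw [← hmul, e2, hone]
      exact (left_inv_eq_right_inv c a).symm
    have key : P (h := ρ) (WithConv.toConv (cleftAction γ γinv u)) =
        P (h := ι) (WithConv.toConv (cleftAction γ γinv u)) := by
      rw [cleft_eq]
      simp only [hmul, hconst]
      rw [hργ, hρι, mul_assoc _ j, hcomm, ← mul_assoc, mul_assoc _ j, hj]
    exact congrArg (fun f => f.ofConv b) key
  · intro b
    have h : WithConv.toConv (cleftAction γ γinv 1) = 1 := by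
      rw [cleft_eq, conv_mul_cConst, LinearMap.mulRight_one, LinearMap.id_comp, e1]
    have := congrArg (fun f => f.ofConv b) h
    refine this.trans ?_
    change (1 : WithConv (B →ₗ[k] E)) b = _
    simp [Algebra.algebraMap_eq_smul_one]
  · intro b u hu v hv
    have h : WithConv.toConv (cleftAction γ γinv (u * v)) =
        WithConv.toConv (cleftAction γ γinv u) * WithConv.toConv (cleftAction γ γinv v) := by
      have hc : cConst k B (u * v) = cConst k B u * cConst k B v := by
        rw [cConst, cConst, conv_mul_cConst]
        ext b
        simp
      have a : ∀ x y g g' : WithConv (B →ₗ[k] E), g' * g = 1 →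
          g * (x * y) * g' = g * x * g' * (g * y * g') := by
        intro x y g g' hg
        calc g * (x * y) * g' = g * x * 1 * y * g' := by simp only [mul_assoc, mul_one, one_mul]
          _ = _ := by rw [← hg]; simp only [mul_assoc]
      rw [cleft_eq, cleft_eq, cleft_eq, hc]
      exact a _ _ _ _ e2
    exact congrArg (fun f => f.ofConv b) h
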